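/- For every integer ℓ ≥ 1 and every complex q with |q| < 1, ∑_{n=0}^{∞} (-1)^n q^{n² + ℓn} / (-q;q)_n = (1/(-q;q)_∞) · ∑_{n=0}^{∞} q^{n(n+1)/2} ∑_{m=0}^{n} [n+ℓ-1 choose m+ℓ-1]_q · q^{m² + ℓm} / (q;q)_m. -/

import Mathlib

open scoped BigOperators

/-- The finite q-Pochhammer symbol `(a;q)_n`. -/
noncomputable def qPoch (a q : ℂ) (n : ℕ) : ℂ := ∏ k ∈ Finset.range n, (1 - a * q ^ k)

/-- The infinite q-Pochhammer symbol `(a;q)_∞`. -/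
noncomputable def qPochInf (a q : ℂ) : ℂ := ∏' k : ℕ, (1 - a * q ^ k)

/-- The Gaussian binomial coefficient `[N choose n]_q`. -/
noncomputable def qbinom (q : ℂ) (N n : ℕ) : ℂ :=
  if n ≤ N then qPoch q q N / (qPoch q q n * qPoch q q (N - n)) else 0

open Filter Topology Finset

section qPochhammer

variable {q : ℂ}

lemma qPoch_zero (a q : ℂ) : qPoch a q 0 = 1 := by simp [qPoch]

lemma qPoch_succ (a q : ℂ) (n : ℕ) : qPoch a q (n + 1) = qPoch a q n * (1 - a * q ^ n) :=
  prod_range_succ _ _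

lemma qPoch_succ_left (a q : ℂ) (n : ℕ) :
    qPoch a q (n + 1) = (1 - a) * qPoch (a * q) q n := by
  rw [qPoch, prod_range_succ', qPoch, mul_comm]
  simp [pow_succ', mul_assoc]

lemma qPoch_add (a q : ℂ) (m n : ℕ) :
    qPoch a q (m + n) = qPoch a q m * qPoch (a * q ^ m) q n := by
  simp [qPoch, prod_range_add, pow_add, mul_assoc]

lemma qPoch_self_succ (q : ℂ) (n : ℕ) : qPoch q q (n + 1) = qPoch q q n * (1 - q ^ (n + 1)) := by
  rw [qPoch_succ, pow_succ']

lemma one_sub_pow_ne_zero (hq : ‖q‖ < 1) (n : ℕ) : 1 - q ^ (n + 1) ≠ 0 := fun h => by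
  have := pow_lt_one₀ (norm_nonneg q) hq n.succ_ne_zero
  rw [← norm_pow, ← sub_eq_zero.1 h] at this
  simp at this

lemma qPoch_self_ne_zero (hq : ‖q‖ < 1) (n : ℕ) : qPoch q q n ≠ 0 :=
  prod_ne_zero_iff.2 fun k _ => by simpa [pow_succ'] using one_sub_pow_ne_zero hq k

lemma norm_qPoch_self_inv_le (hq : ‖q‖ < 1) (n : ℕ) :
    ‖(qPoch q q n)⁻¹‖ ≤ (1 - ‖q‖)⁻¹ ^ n := by
  rw [norm_inv, inv_pow, qPoch, norm_prod]
  have h0 : 0 < 1 - ‖q‖ := sub_pos.2 hq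
  refine inv_anti₀ (by positivity) ?_
  rw [← card_range n, ← prod_const, card_range]
  refine prod_le_prod (fun _ _ => h0.le) fun k _ => ?_
  have h1 : ‖q * q ^ k‖ ≤ ‖q‖ := by
    rw [norm_mul, norm_pow]
    exact mul_le_of_le_one_right (norm_nonneg q) (pow_le_one₀ (norm_nonneg q) hq.le)
  have h2 := norm_sub_norm_le 1 (q * q ^ k)
  rw [norm_one] at h2
  linarith

end qPochhammer

lemma summable_pow_choose_two_mul_pow {r : ℝ} (hr0 : 0 ≤ r) (hr : r < 1) (C : ℝ) :
    Summable fun k : ℕ => r ^ (k + 1).choose 2 * C ^ k := by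
  have hlim : Tendsto (fun k : ℕ => r ^ (k + 1) * |C|) atTop (𝓝 0) := by
    simpa using ((tendsto_pow_atTop_nhds_zero_of_lt_one hr0 hr).comp
      (tendsto_add_atTop_nat 1)).mul_const |C|
  refine summable_of_ratio_norm_eventually_le (r := 1 / 2) (by norm_num) ?_
  filter_upwards [hlim.eventually_le_const (show (0 : ℝ) < 1 / 2 by norm_num)] with k hk
  have : r ^ (k + 1 + 1).choose 2 * C ^ (k + 1)
      = r ^ (k + 1) * C * (r ^ (k + 1).choose 2 * C ^ k) := by
    rw [Nat.choose_succ_succ' (k + 1) 1, Nat.choose_one_right]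
    ring
  rw [this, norm_mul]
  refine mul_le_mul_of_nonneg_right ?_ (norm_nonneg _)
  rwa [norm_mul, norm_pow, Real.norm_of_nonneg hr0, Real.norm_eq_abs]

section Euler

variable {q : ℂ}

/-- The terms of Euler's series for `(-q;q)_∞`. -/
noncomputable def eulerTerm (q : ℂ) (k : ℕ) : ℂ := q ^ (k + 1).choose 2 / qPoch q q k

/-- Euler's series `∑ q^{k(k+1)/2 + nk} / (q;q)_k` for `(-q^{n+1};q)_∞`. -/
noncomputable def eulerSeries (q : ℂ) (n : ℕ) : ℂ := ∑' k, eulerTerm q k * q ^ (n * k)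

lemma summable_norm_eulerTerm (hq : ‖q‖ < 1) : Summable fun k => ‖eulerTerm q k‖ := by
  refine Summable.of_nonneg_of_le (fun _ => norm_nonneg _) (fun k => ?_)
    (summable_pow_choose_two_mul_pow (norm_nonneg q) hq (1 - ‖q‖)⁻¹)
  rw [eulerTerm, div_eq_mul_inv, norm_mul, norm_pow]
  gcongr
  exact norm_qPoch_self_inv_le hq k

lemma norm_eulerTerm_mul_pow_le (hq : ‖q‖ < 1) (n k : ℕ) :
    ‖eulerTerm q k * q ^ n‖ ≤ ‖eulerTerm q k‖ := by
  rw [norm_mul, norm_pow]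
  exact mul_le_of_le_one_right (norm_nonneg _) (pow_le_one₀ (norm_nonneg q) hq.le)

lemma summable_eulerTerm_mul_pow (hq : ‖q‖ < 1) (n : ℕ) :
    Summable fun k => eulerTerm q k * q ^ (n * k) :=
  Summable.of_norm_bounded (summable_norm_eulerTerm hq)
    fun k => norm_eulerTerm_mul_pow_le hq (n * k) k

lemma eulerTerm_succ_mul (hq : ‖q‖ < 1) (k : ℕ) :
    eulerTerm q (k + 1) * (1 - q ^ (k + 1)) = eulerTerm q k * q ^ (k + 1) := by
  have h1 := one_sub_pow_ne_zero hq k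
  have h2 := qPoch_self_ne_zero hq k
  rw [eulerTerm, eulerTerm, qPoch_self_succ, Nat.choose_succ_succ' (k + 1) 1,
    Nat.choose_one_right, pow_add]
  field_simp

lemma eulerSeries_eq_mul_succ (hq : ‖q‖ < 1) (n : ℕ) :
    eulerSeries q n = (1 + q ^ (n + 1)) * eulerSeries q (n + 1) := by
  have h0 := summable_eulerTerm_mul_pow hq n
  have h1 := summable_eulerTerm_mul_pow hq (n + 1)
  have key : eulerSeries q n - eulerSeries q (n + 1) = q ^ (n + 1) * eulerSeries q (n + 1) := by
    rw [eulerSeries, eulerSeries, ← h0.tsum_sub h1, (h0.sub h1).tsum_eq_zero_add, ← tsum_mul_left]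
    simp only [mul_zero, pow_zero, sub_self, zero_add]
    refine tsum_congr fun k => ?_
    calc _ = eulerTerm q (k + 1) * (1 - q ^ (k + 1)) * q ^ (n * (k + 1)) := by ring
      _ = _ := by rw [eulerTerm_succ_mul hq]; ring
  linear_combination key

lemma eulerSeries_zero_eq (hq : ‖q‖ < 1) (n : ℕ) :
    eulerSeries q 0 = qPoch (-q) q n * eulerSeries q n := by
  induction n with
  | zero => simp [qPoch_zero]
  | succ n ih =>
    rw [ih, qPoch_succ, eulerSeries_eq_mul_succ hq n]
    ring

lemma tendsto_eulerSeries (hq : ‖q‖ < 1) : Tendsto (eulerSeries q) atTop (𝓝 1) := by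
  rw [← tsum_ite_eq (0 : ℕ) (fun _ => (1 : ℂ))]
  refine tendsto_tsum_of_dominated_convergence (summable_norm_eulerTerm hq) (fun k => ?_)
    (Eventually.of_forall fun n k => norm_eulerTerm_mul_pow_le hq (n * k) k)
  rcases eq_or_ne k 0 with rfl | hk
  · simp [eulerTerm, qPoch_zero]
  · have hlt : ‖q ^ k‖ < 1 := by
      rw [norm_pow]
      exact pow_lt_one₀ (norm_nonneg q) hq hk
    simpa [hk, pow_mul'] using
      (tendsto_pow_atTop_nhds_zero_of_norm_lt_one hlt).const_mul (eulerTerm q k)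

lemma qPoch_neg_self_ne_zero (hq : ‖q‖ < 1) (n : ℕ) : qPoch (-q) q n ≠ 0 :=
  prod_ne_zero_iff.2 fun k _ h => by
    have := pow_lt_one₀ (norm_nonneg q) hq k.succ_ne_zero
    rw [← norm_pow, show q ^ (k + 1) = -1 by linear_combination h] at this
    simp at this

lemma eulerSeries_zero_ne_zero (hq : ‖q‖ < 1) : eulerSeries q 0 ≠ 0 := by
  obtain ⟨n, hn⟩ := ((tendsto_eulerSeries hq).eventually_ne one_ne_zero).exists
  rw [eulerSeries_zero_eq hq n]
  exact mul_ne_zero (qPoch_neg_self_ne_zero hq n) hn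

/-- Euler's identity for `(-q;q)_∞`. -/
lemma qPochInf_neg_self (hq : ‖q‖ < 1) : qPochInf (-q) q = eulerSeries q 0 := by
  have hm : Multipliable fun k : ℕ => 1 - -q * q ^ k := by
    simp only [sub_eq_add_neg]
    refine multipliable_one_add_of_summable ?_
    simpa [norm_mul, norm_pow] using
      (summable_geometric_of_lt_one (norm_nonneg q) hq).mul_left ‖q‖
  refine tendsto_nhds_unique hm.hasProd.tendsto_prod_nat ?_
  have h : Tendsto (fun n => eulerSeries q 0 / eulerSeries q n) atTop (𝓝 (eulerSeries q 0)) := by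
    simpa only [Pi.div_def, div_one] using
      tendsto_const_nhds.div (tendsto_eulerSeries hq) one_ne_zero
  refine h.congr' ?_
  filter_upwards [(tendsto_eulerSeries hq).eventually_ne one_ne_zero] with n hn
  rw [eulerSeries_zero_eq hq n, mul_div_cancel_right₀ _ hn]
  rfl

end Euler

section FiniteIdentities

variable {q : ℂ}

lemma sum_antidiagonal_qPoch_eq_inv (hq : ‖q‖ < 1) (n : ℕ) (x : ℂ) :
    ∑ p ∈ antidiagonal n, q ^ p.1 ^ 2 * x ^ p.1 * qPoch (x * q ^ (p.1 + 1)) q p.2 /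
      (qPoch q q p.1 * qPoch q q p.2) = 1 / qPoch q q n := by
  induction n generalizing x with
  | zero => simp [qPoch_zero]
  | succ n ih =>
    set T : ℂ → ℕ × ℕ → ℂ := fun x p => q ^ p.1 ^ 2 * x ^ p.1 *
      qPoch (x * q ^ (p.1 + 1)) q p.2 / (qPoch q q p.1 * qPoch q q p.2) with hT
    have hn := one_sub_pow_ne_zero hq n
    have hsplit : (1 - q ^ (n + 1)) * ∑ p ∈ antidiagonal (n + 1), T x p
        = ∑ p ∈ antidiagonal (n + 1), (1 - q ^ p.2) * T x p
          + ∑ p ∈ antidiagonal (n + 1), q ^ p.2 * (1 - q ^ p.1) * T x p := by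
      rw [mul_sum, ← sum_add_distrib]
      refine sum_congr rfl fun p hp => ?_
      rw [← mem_antidiagonal.1 hp, pow_add]
      ring
    have hleft : ∑ p ∈ antidiagonal (n + 1), (1 - q ^ p.2) * T x p
        = (1 - x * q ^ (n + 1)) * ∑ p ∈ antidiagonal n, T x p := by
      rw [Nat.sum_antidiagonal_succ', mul_sum]
      simp only [pow_zero, sub_self, zero_mul, zero_add]
      refine sum_congr rfl fun p hp => ?_
      rw [← mem_antidiagonal.1 hp]
      have h1 := one_sub_pow_ne_zero hq p.2
      have h2 := qPoch_self_ne_zero hq p.2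
      have h3 := qPoch_self_ne_zero hq p.1
      simp only [hT, qPoch_self_succ, qPoch_succ (x * q ^ (p.1 + 1))]
      field_simp
      ring
    have hright : ∑ p ∈ antidiagonal (n + 1), q ^ p.2 * (1 - q ^ p.1) * T x p
        = x * q ^ (n + 1) * ∑ p ∈ antidiagonal n, T (x * q) p := by
      rw [Nat.sum_antidiagonal_succ, mul_sum]
      simp only [pow_zero, sub_self, zero_mul, mul_zero, zero_add]
      refine sum_congr rfl fun p hp => ?_
      rw [← mem_antidiagonal.1 hp]
      have h1 := one_sub_pow_ne_zero hq p.1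
      have h2 := qPoch_self_ne_zero hq p.2
      have h3 := qPoch_self_ne_zero hq p.1
      have h4 : x * q * q ^ (p.1 + 1) = x * q ^ (p.1 + 1 + 1) := by ring
      simp only [hT, qPoch_self_succ, h4]
      field_simp
      ring
    rw [hleft, hright, ih, ih] at hsplit
    rw [qPoch_self_succ, ← div_div, eq_div_iff hn, mul_comm, hsplit]
    ring

lemma sum_antidiagonal_qPoch_eq_alternating (hq : ‖q‖ < 1) (n : ℕ) (x : ℂ) :
    ∑ p ∈ antidiagonal n, q ^ p.1 ^ 2 * x ^ p.1 * qPoch (x * q ^ p.1) q p.2 /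
      (qPoch q q p.1 * qPoch q q p.2)
    = ∑ p ∈ antidiagonal n, (-1) ^ p.1 * q ^ p.1.choose 2 * x ^ p.1 / qPoch q q p.2 := by
  induction n generalizing x with
  | zero => simp [qPoch_zero]
  | succ n ih =>
    have hrec : ∑ p ∈ antidiagonal (n + 1), q ^ p.1 ^ 2 * x ^ p.1 * qPoch (x * q ^ p.1) q p.2 /
          (qPoch q q p.1 * qPoch q q p.2)
        + x * ∑ p ∈ antidiagonal n, q ^ p.1 ^ 2 * (x * q) ^ p.1 *
          qPoch (x * q * q ^ p.1) q p.2 / (qPoch q q p.1 * qPoch q q p.2)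
        = 1 / qPoch q q (n + 1) := by
      rw [← sum_antidiagonal_qPoch_eq_inv hq (n + 1) x, Nat.sum_antidiagonal_succ',
        Nat.sum_antidiagonal_succ', mul_sum, add_assoc, ← sum_add_distrib]
      simp only [qPoch_zero]
      congr 1
      refine sum_congr rfl fun p _ => ?_
      have h1 := one_sub_pow_ne_zero hq p.2
      have h2 := qPoch_self_ne_zero hq p.2
      have h3 := qPoch_self_ne_zero hq p.1
      have h4 : x * q * q ^ p.1 = x * q ^ (p.1 + 1) := by ring
      have h5 : x * q ^ p.1 * q = x * q ^ (p.1 + 1) := by ring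
      rw [qPoch_self_succ, qPoch_succ_left (x * q ^ p.1), qPoch_succ (x * q ^ (p.1 + 1)), h4, h5]
      field_simp
      ring
    rw [eq_sub_of_add_eq hrec, ih, Nat.sum_antidiagonal_succ, mul_sum, sub_eq_add_neg,
      ← sum_neg_distrib]
    congr 1
    · simp
    · refine sum_congr rfl fun p _ => ?_
      rw [Nat.choose_succ_succ' p.1 1, Nat.choose_one_right]
      ring

lemma choose_two_add_add_one (m s : ℕ) :
    (m + s + 1).choose 2 + m.choose 2 = m ^ 2 + (s + 1).choose 2 + m * s := by
  have h : ((m + s + 1).choose 2 + m.choose 2 : ℚ) = m ^ 2 + (s + 1).choose 2 + m * s := by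
    simp only [Nat.cast_choose_two]
    push_cast
    ring
  exact_mod_cast h

lemma sum_qbinom_eq (hq : ‖q‖ < 1) {l : ℕ} (hl : 1 ≤ l) (n : ℕ) :
    q ^ (n * (n + 1) / 2) * ∑ m ∈ range (n + 1),
        qbinom q (n + l - 1) (m + l - 1) * q ^ (m ^ 2 + l * m) / qPoch q q m
      = ∑ p ∈ antidiagonal n,
          (-1) ^ p.1 * q ^ (p.1 ^ 2 + l * p.1) * (eulerTerm q p.2 * q ^ (p.1 * p.2)) := by
  obtain ⟨a, rfl⟩ := Nat.exists_eq_add_of_le' hl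
  have htri : n * (n + 1) / 2 = (n + 1).choose 2 := by
    rw [Nat.choose_two_right, Nat.add_sub_cancel, mul_comm]
  have hsum : ∑ m ∈ range (n + 1),
      qbinom q (n + (a + 1) - 1) (m + (a + 1) - 1) * q ^ (m ^ 2 + (a + 1) * m) / qPoch q q m
      = ∑ p ∈ antidiagonal n, q ^ p.1 ^ 2 * (q ^ (a + 1)) ^ p.1 *
        qPoch (q ^ (a + 1) * q ^ p.1) q p.2 / (qPoch q q p.1 * qPoch q q p.2) := by
    rw [← Nat.sum_antidiagonal_eq_sum_range_succ_mk
      (fun p : ℕ × ℕ => qbinom q (n + (a + 1) - 1) (p.1 + (a + 1) - 1) *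
        q ^ (p.1 ^ 2 + (a + 1) * p.1) / qPoch q q p.1)]
    refine sum_congr rfl fun p hp => ?_
    rw [← mem_antidiagonal.1 hp, qbinom, if_pos (by omega),
      show p.1 + p.2 + (a + 1) - 1 = p.1 + a + p.2 by omega,
      show p.1 + (a + 1) - 1 = p.1 + a by omega,
      show p.1 + a + p.2 - (p.1 + a) = p.2 by omega, qPoch_add,
      show q * q ^ (p.1 + a) = q ^ (a + 1) * q ^ p.1 by ring]
    have h1 := qPoch_self_ne_zero hq (p.1 + a)
    have h2 := qPoch_self_ne_zero hq p.2
    have h3 := qPoch_self_ne_zero hq p.1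
    field_simp
    ring
  rw [hsum, sum_antidiagonal_qPoch_eq_alternating hq, mul_sum, htri]
  refine sum_congr rfl fun p hp => ?_
  have hexp : q ^ (n + 1).choose 2 * q ^ p.1.choose 2
      = q ^ p.1 ^ 2 * q ^ (p.2 + 1).choose 2 * q ^ (p.1 * p.2) := by
    rw [← mem_antidiagonal.1 hp, ← pow_add, choose_two_add_add_one, pow_add, pow_add]
  rw [eulerTerm, pow_add, pow_mul]
  linear_combination (-1) ^ p.1 * (q ^ (a + 1)) ^ p.1 / qPoch q q p.2 * hexp

end FiniteIdentities

lemma tsum_prod_eq_tsum_sum_antidiagonal {f : ℕ × ℕ → ℂ} (hf : Summable f) :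
    ∑' n, ∑ p ∈ antidiagonal n, f p = ∑' m, ∑' s, f (m, s) := by
  have hs := HasAntidiagonal.sigmaAntidiagonalEquivProd.summable_iff.2 hf
  rw [← Summable.tsum_prod hf, ← HasAntidiagonal.sigmaAntidiagonalEquivProd.tsum_eq f]
  refine Eq.trans (tsum_congr fun n => ?_)
    (hs.tsum_sigma' fun n => (hasSum_fintype _).summable).symm
  rw [tsum_fintype, ← sum_coe_sort]
  rfl

lemma summable_double_series {q : ℂ} (hq : ‖q‖ < 1) (l : ℕ) :
    Summable fun p : ℕ × ℕ =>
      (-1) ^ p.1 * q ^ (p.1 ^ 2 + l * p.1) * (eulerTerm q p.2 * q ^ (p.1 * p.2)) := by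
  refine Summable.of_norm_bounded ((summable_geometric_of_lt_one (norm_nonneg q) hq).mul_of_nonneg
    (summable_norm_eulerTerm hq) (fun _ => by positivity) fun _ => norm_nonneg _) fun p => ?_
  rw [norm_mul]
  refine mul_le_mul ?_ (norm_eulerTerm_mul_pow_le hq _ _) (norm_nonneg _) (by positivity)
  rw [norm_mul, norm_pow, norm_neg, norm_one, one_pow, one_mul, norm_pow]
  exact pow_le_pow_of_le_one (norm_nonneg q) hq.le (by nlinarith)

theorem sigma2_ell_double_sum (ℓ : ℕ) (hℓ : 1 ≤ ℓ) (q : ℂ) (hq : ‖q‖ < 1) :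
    ∑' n : ℕ, (-1 : ℂ) ^ n * q ^ (n ^ 2 + ℓ * n) / qPoch (-q) q n
      = (1 / qPochInf (-q) q) *
          ∑' n : ℕ, q ^ (n * (n + 1) / 2) *
            ∑ m ∈ Finset.range (n + 1),
              qbinom q (n + ℓ - 1) (m + ℓ - 1) * q ^ (m ^ 2 + ℓ * m) / qPoch q q m := by
  have hne := eulerSeries_zero_ne_zero hq
  have hs := summable_double_series hq ℓ
  simp only [sum_qbinom_eq hq hℓ]
  rw [qPochInf_neg_self hq, tsum_prod_eq_tsum_sum_antidiagonal hs, ← tsum_mul_left]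
  refine tsum_congr fun n => ?_
  dsimp only
  rw [tsum_mul_left, ← eulerSeries, eulerSeries_zero_eq hq n]
  have h1 := qPoch_neg_self_ne_zero hq n
  have h2 : eulerSeries q n ≠ 0 := right_ne_zero_of_mul (eulerSeries_zero_eq hq n ▸ hne)
  field_simp
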